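/- arXiv:2401.02745 — 2 statements merged into one kernel-verified Lean document; each statement's English description precedes it below -/
import Mathlib

section
/- Meta-substitution lemma for de Bruijn terms: for all de Bruijn terms A, B, C and all indices i, n with 1 ≤ i ≤ n, A{{i ← B}}{{n ← C}} = A{{n+1 ← C}}{{i ← B{{n−i+1 ← C}}}}. -/
/-- De Bruijn terms: indices (positive natural numbers), application, abstraction.
`var n` stands for the index n. -/
inductive Db : Type
  | var : ℕ → Db
  | app : Db → Db → Db
  | lam : Db → Db
  deriving DecidableEq

namespace Db

/-- The meta-updating function U^i_k: U^i_k(n) = n+i−1 if n > k and n otherwise. -/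
def upd (i k : ℕ) : Db → Db
  | var n => if k < n then var (n + i - 1) else var n
  | app A B => app (upd i k A) (upd i k B)
  | lam A => lam (upd i (k + 1) A)

/-- Meta-substitution A{{i ← B}} at level i: n{{i ← B}} = n−1 if n > i,
U^i_0(B) if n = i, and n if n < i. -/
def subst : Db → ℕ → Db → Db
  | var n, i, B => if i < n then var (n - 1) else if n = i then upd i 0 B else var n
  | app A₁ A₂, i, B => app (subst A₁ i B) (subst A₂ i B)
  | lam A, i, B => lam (subst A (i + 1) B)

end Db

namespace Db

theorem upd_upd {i j k p : ℕ} (A : Db) (hpk : p ≤ k) (hkj : k < p + j) :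
    upd (i + 1) k (upd j p A) = upd (j + i) p A := by
  induction A generalizing k p with
  | var m => grind [upd]
  | app A₁ A₂ ih₁ ih₂ => simp only [upd, ih₁ hpk hkj, ih₂ hpk hkj]
  | lam A ih => simp only [upd, ih (show p + 1 ≤ k + 1 by omega) (by omega)]

/-- Substituting at a level skipped by an update only lowers the update. -/
theorem subst_upd_of_lt {i k n : ℕ} (A B : Db) (hkn : k < n) (hni : n ≤ k + i) :
    subst (upd (i + 1) k A) n B = upd i k A := by
  induction A generalizing k n with
  | var m => grind [upd, subst]
  | app A₁ A₂ ih₁ ih₂ => simp only [upd, subst, ih₁ hkn hni, ih₂ hkn hni]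
  | lam A ih => simp only [upd, subst, ih (show k + 1 < n + 1 by omega) (by omega)]

/-- Substituting above the levels skipped by an update commutes with the update. -/
theorem subst_upd_of_le {i k n : ℕ} (A B : Db) (hkn : k < n) :
    subst (upd (i + 1) k A) (n + i) B = upd (i + 1) k (subst A n B) := by
  induction A generalizing k n with
  | var m =>
    have h := upd_upd (i := i) (j := n) (p := 0) B (Nat.zero_le k) (by omega)
    grind [upd, subst]
  | app A₁ A₂ ih₁ ih₂ => simp only [upd, subst, ih₁ hkn, ih₂ hkn]
  | lam A ih =>
    have h := ih (show k + 1 < n + 1 by omega)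
    rw [Nat.add_right_comm] at h
    simp only [upd, subst, h]

end Db

/-- Meta-substitution lemma: for 1 ≤ i ≤ n,
A{{i ← B}}{{n ← C}} = A{{n+1 ← C}}{{i ← B{{n−i+1 ← C}}}}. -/
theorem meta_substitution_lemma (A B C : Db) (i n : ℕ) (h1 : 1 ≤ i) (h2 : i ≤ n) :
    Db.subst (Db.subst A i B) n C
      = Db.subst (Db.subst A (n + 1) C) i (Db.subst B (n - i + 1) C) := by
  induction A generalizing i n with
  | var m =>
    have hlt := Db.subst_upd_of_lt (i := n) (k := 0) (n := i) C
      (Db.subst B (n - i + 1) C) (by omega) (by omega)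
    have hle := Db.subst_upd_of_le (i := i - 1) (k := 0) (n := n - i + 1) B C (by omega)
    rw [Nat.sub_add_cancel h1, show n - i + 1 + (i - 1) = n by omega] at hle
    grind [Db.subst]
  | app A₁ A₂ ih₁ ih₂ => simp only [Db.subst, ih₁ i n h1 h2, ih₂ i n h1 h2]
  | lam A ih =>
    have h := ih (i + 1) (n + 1) (by omega) (by omega)
    rw [Nat.add_sub_add_right] at h
    simp only [Db.subst, h]
end

section
/- Distribution lemma for de Bruijn terms: for all de Bruijn terms A, B and all indices i ≥ 1, k ≥ 0, n ≥ 1 with n ≤ k+1, U^i_k(A{{n ← B}}) = (U^i_{k+1}(A)){{n ← U^i_{k−n+1}(B)}}. -/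
/-- Updating functions commute when the inner cutoff `p` is at most the outer one. -/
theorem Db.upd_upd_s19 (B : Db) (i j n p : ℕ) (hi : 1 ≤ i) (hn : 1 ≤ n) :
    Db.upd i (j + p + n - 1) (Db.upd n p B) = Db.upd n p (Db.upd i (j + p) B) := by
  induction B generalizing p with
  | var m => grind [Db.upd]
  | app A B ihA ihB => simp only [Db.upd, ihA, ihB]
  | lam A ih =>
    have h := ih (p + 1)
    rw [show j + (p + 1) + n - 1 = j + p + n - 1 + 1 by lia] at h
    simp only [Db.upd, h, ← Nat.add_assoc]

/-- Distribution lemma: for i ≥ 1, n ≥ 1 and n ≤ k+1,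
U^i_k(A{{n ← B}}) = (U^i_{k+1}(A)){{n ← U^i_{k−n+1}(B)}}. -/
theorem distribution_lemma (A B : Db) (i k n : ℕ)
    (h1 : 1 ≤ i) (h2 : 1 ≤ n) (h3 : n ≤ k + 1) :
    Db.upd i k (Db.subst A n B)
      = Db.subst (Db.upd i (k + 1) A) n (Db.upd i (k + 1 - n) B) := by
  induction A generalizing k n with
  | var m =>
    have h := Db.upd_upd_s19 B i (k + 1 - n) n 0 h1 h2
    rw [Nat.add_zero, show k + 1 - n + n - 1 = k by lia] at h
    grind [Db.upd, Db.subst]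
  | app A₁ A₂ ih₁ ih₂ => simp only [Db.upd, Db.subst, ih₁ k n h2 h3, ih₂ k n h2 h3]
  | lam A ih =>
    have h := ih (k + 1) (n + 1) (by lia) (by lia)
    rw [Nat.add_sub_add_right] at h
    simp only [Db.upd, Db.subst, h]
end
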